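/- Let λ > 0, p > 0, q > 0, τ ∈ ℝ, −1 ≤ δ < p−1, let a ∈ A^τ_δ(ℝ), let φ be a cut-off function and ψ := 1 − φ, and set l_{p,q} := [ (q+τ)⁺ / (p−1−δ) ] + 1 where t⁺ := max{t,0} and [·] is the floor. Then the oscillatory integral Ĩ^±_{p,q}[aψ](λ) := Os-∫₀^∞ e^{±iλx^p} x^{q−1} a(x) ψ(x) dx exists (the defining limit exists and is independent of the choice of χ in S(ℝ) with χ(0)=1), and for every integer l ≥ l_{p,q} it satisfies Ĩ^±_{p,q}[aψ](λ) = ∫₀^∞ e^{±iλx^p} (±L*)^l (x^{q−1} a(x) ψ(x)) dx, with the right-hand integral absolutely convergent; moreover for each such l there is a constant C_l > 0 such that |Ĩ^±_{p,q}[aψ](λ)| ≤ C_l |a|^{(τ)}_l λ^{−l} for all λ > 0. -/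

import Mathlib

open MeasureTheory Filter Topology Set

/-- The amplitude class `A^τ_δ(ℝ)`. -/
def AmpClass (τ δ : ℝ) (a : ℝ → ℂ) : Prop :=
  ContDiff ℝ (⊤ : ℕ∞) a ∧ ∀ k : ℕ, ∃ C : ℝ, 0 < C ∧ ∀ x : ℝ,
    ‖iteratedDeriv k a x‖ ≤ C * (1 + x ^ 2) ^ ((τ + δ * k) / 2)

/-- The seminorm `|a|^{(τ)}_l := max_{0≤k≤l} sup_x ⟨x⟩^{-(τ+δk)} |a^{(k)}(x)|`. -/
noncomputable def ampSeminorm (τ δ : ℝ) (a : ℝ → ℂ) (l : ℕ) : ℝ :=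
  ⨆ k : Fin (l + 1), ⨆ x : ℝ,
    (1 + x ^ 2) ^ (-(τ + δ * ((k : ℕ) : ℝ)) / 2) * ‖iteratedDeriv k a x‖

/-- A cut-off function. -/
def IsCutoff (φ : ℝ → ℂ) : Prop :=
  ContDiff ℝ (⊤ : ℕ∞) φ ∧ ∃ r₀ r₁ : ℝ, 1 ≤ r₀ ∧ r₀ < r₁ ∧
    (∀ x : ℝ, |x| ≤ r₀ → φ x = 1) ∧ ∀ x : ℝ, r₁ ≤ |x| → φ x = 0

/-- The formal adjoint operator `L* g (x) = -(1/(iλ)) d/dx [ g(x) / (p x^{p-1}) ]`. -/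
noncomputable def Lstar (lam p : ℝ) (g : ℝ → ℂ) : ℝ → ℂ :=
  fun x => -(1 / (Complex.I * lam)) * deriv (fun y => g y / ((p * y ^ (p - 1) : ℝ) : ℂ)) x

/-- `SymbolBound δ N m M f` says that `f` has `N` derivatives on `(0, ∞)`, the last of which is
continuous there, and that `‖f⁽ᵏ⁾(x)‖ ≤ M x ^ (m + δ k)` for all `k ≤ N` and `x ≥ 1`. -/
def SymbolBound (δ : ℝ) : ℕ → ℝ → ℝ → (ℝ → ℂ) → Prop
  | 0, m, M, f => ContinuousOn f (Ioi 0) ∧ ∀ x : ℝ, 1 ≤ x → ‖f x‖ ≤ M * x ^ m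
  | N + 1, m, M, f => DifferentiableOn ℝ f (Ioi 0) ∧ (∀ x : ℝ, 1 ≤ x → ‖f x‖ ≤ M * x ^ m) ∧
      SymbolBound δ N (m + δ) M (deriv f)

namespace SymbolBound

variable {δ m m' M M' : ℝ} {N : ℕ} {f g : ℝ → ℂ}

theorem continuousOn (h : SymbolBound δ N m M f) : ContinuousOn f (Ioi 0) := by
  cases N with
  | zero => exact h.1
  | succ N => exact h.1.continuousOn

theorem norm_le (h : SymbolBound δ N m M f) {x : ℝ} (hx : 1 ≤ x) : ‖f x‖ ≤ M * x ^ m := by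
  cases N with
  | zero => exact h.2 x hx
  | succ N => exact h.2.1 x hx

theorem nonneg (h : SymbolBound δ N m M f) : 0 ≤ M := by
  simpa using (norm_nonneg _).trans (h.norm_le le_rfl)

theorem differentiableAt (h : SymbolBound δ (N + 1) m M f) {x : ℝ} (hx : 0 < x) :
    DifferentiableAt ℝ f x :=
  h.1.differentiableAt (Ioi_mem_nhds hx)

theorem congr (h : SymbolBound δ N m M f) (hfg : EqOn g f (Ioi 0)) : SymbolBound δ N m M g := by
  induction N generalizing m f g with
  | zero =>
    refine ⟨h.1.congr hfg, fun x hx => ?_⟩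
    rw [hfg (show 0 < x by linarith)]
    exact h.2 x hx
  | succ N ih =>
    refine ⟨h.1.congr hfg, fun x hx => ?_, ih h.2.2 fun x hx => ?_⟩
    · rw [hfg (show 0 < x by linarith)]
      exact h.2.1 x hx
    · exact (hfg.eventuallyEq_of_mem (Ioi_mem_nhds hx)).deriv_eq

theorem mono (h : SymbolBound δ N m M f) (hm : m ≤ m') (hM : M ≤ M') :
    SymbolBound δ N m' M' f := by
  have key : ∀ {m m' : ℝ}, m ≤ m' → ∀ x : ℝ, 1 ≤ x → M * x ^ m ≤ M' * x ^ m' :=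
    fun hm x hx => mul_le_mul hM (Real.rpow_le_rpow_of_exponent_le hx hm)
      (Real.rpow_nonneg (by linarith) _) (h.nonneg.trans hM)
  induction N generalizing m m' f with
  | zero => exact ⟨h.1, fun x hx => (h.2 x hx).trans (key hm x hx)⟩
  | succ N ih =>
    exact ⟨h.1, fun x hx => (h.2.1 x hx).trans (key hm x hx), ih h.2.2 (by linarith)⟩

theorem of_succ (h : SymbolBound δ (N + 1) m M f) : SymbolBound δ N m M f := by
  induction N generalizing m f with
  | zero => exact ⟨h.continuousOn, h.2.1⟩
  | succ N ih => exact ⟨h.1, h.2.1, ih h.2.2⟩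

theorem of_le {N' : ℕ} (h : SymbolBound δ N' m M f) (hN : N ≤ N') : SymbolBound δ N m M f := by
  induction hN with
  | refl => exact h
  | step _ ih => exact ih h.of_succ

theorem add (hf : SymbolBound δ N m M f) (hg : SymbolBound δ N m M' g) :
    SymbolBound δ N m (M + M') (fun x => f x + g x) := by
  have key : ∀ x : ℝ, 1 ≤ x → ‖f x + g x‖ ≤ (M + M') * x ^ m := fun x hx => by
    rw [add_mul]
    exact (norm_add_le _ _).trans (add_le_add (hf.norm_le hx) (hg.norm_le hx))
  induction N generalizing m f g with
  | zero => exact ⟨hf.1.add hg.1, key⟩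
  | succ N ih =>
    refine ⟨hf.1.add hg.1, key, (ih hf.2.2 hg.2.2 fun x hx => ?_).congr fun x hx => ?_⟩
    · rw [add_mul]
      exact (norm_add_le _ _).trans (add_le_add (hf.2.2.norm_le hx) (hg.2.2.norm_le hx))
    · exact deriv_fun_add (hf.differentiableAt hx) (hg.differentiableAt hx)

theorem norm_mul_le_rpow (hf : SymbolBound δ N m M f) (hg : SymbolBound δ N m' M' g) {x : ℝ}
    (hx : 1 ≤ x) : ‖f x * g x‖ ≤ 2 ^ N * M * M' * x ^ (m + m') := by
  have hx0 : 0 < x := by linarith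
  have hM := hf.nonneg
  have hM' := hg.nonneg
  calc ‖f x * g x‖ ≤ (M * x ^ m) * (M' * x ^ m') := by
        rw [norm_mul]
        exact mul_le_mul (hf.norm_le hx) (hg.norm_le hx) (norm_nonneg _) (by positivity)
    _ = 1 * (M * M' * x ^ (m + m')) := by rw [Real.rpow_add hx0]; ring
    _ ≤ 2 ^ N * (M * M' * x ^ (m + m')) :=
        mul_le_mul_of_nonneg_right (one_le_pow₀ one_le_two) (by positivity)
    _ = _ := by ring

theorem mul (hf : SymbolBound δ N m M f) (hg : SymbolBound δ N m' M' g) :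
    SymbolBound δ N (m + m') (2 ^ N * M * M') (fun x => f x * g x) := by
  induction N generalizing m m' f g with
  | zero => exact ⟨hf.1.mul hg.1, fun x hx => hf.norm_mul_le_rpow hg hx⟩
  | succ N ih =>
    have h1 := (ih hf.2.2 hg.of_succ).mono (m' := m + m' + δ) (by linarith) le_rfl
    have h2 := (ih hf.of_succ hg.2.2).mono (m' := m + m' + δ) (by linarith) le_rfl
    refine ⟨hf.1.mul hg.1, fun x hx => hf.norm_mul_le_rpow hg hx,
      ((h1.add h2).mono le_rfl ?_).congr fun x hx => ?_⟩
    · rw [pow_succ]; linarith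
    · exact deriv_fun_mul (hf.differentiableAt hx) (hg.differentiableAt hx)

theorem const_mul (c : ℂ) (hf : SymbolBound δ N m M f) :
    SymbolBound δ N m (‖c‖ * M) (fun x => c * f x) := by
  have key : ∀ {f : ℝ → ℂ} {m : ℝ}, (∀ x : ℝ, 1 ≤ x → ‖f x‖ ≤ M * x ^ m) →
      ∀ x : ℝ, 1 ≤ x → ‖c * f x‖ ≤ ‖c‖ * M * x ^ m := fun h x hx => by
    rw [norm_mul, mul_assoc]
    exact mul_le_mul_of_nonneg_left (h x hx) (norm_nonneg _)
  induction N generalizing m f with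
  | zero => exact ⟨continuousOn_const.mul hf.1, key hf.2⟩
  | succ N ih =>
    refine ⟨hf.1.const_mul c, key hf.2.1, (ih hf.2.2).congr fun x hx => ?_⟩
    exact deriv_const_mul c (hf.differentiableAt hx)

theorem rpow (hδ : -1 ≤ δ) (N : ℕ) (α : ℝ) :
    ∃ C, SymbolBound δ N α C (fun x => ((x ^ α : ℝ) : ℂ)) := by
  have hderiv : ∀ α : ℝ, ∀ x ∈ Ioi (0 : ℝ), HasDerivAt (fun x : ℝ => ((x ^ α : ℝ) : ℂ))
      ((α : ℂ) * ((x ^ (α - 1) : ℝ) : ℂ)) x := fun α x hx => by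
    simpa using (Real.hasDerivAt_rpow_const (p := α) (Or.inl (ne_of_gt hx))).ofReal_comp
  have key : ∀ α C : ℝ, 1 ≤ C → ∀ x : ℝ, 1 ≤ x → ‖((x ^ α : ℝ) : ℂ)‖ ≤ C * x ^ α :=
    fun α C hC x hx => by
      have hx0 : 0 ≤ x ^ α := Real.rpow_nonneg (by linarith) _
      rw [Complex.norm_real, Real.norm_of_nonneg hx0]
      nlinarith
  induction N generalizing α with
  | zero =>
    exact ⟨1, fun x hx => (hderiv α x hx).continuousAt.continuousWithinAt, key α 1 le_rfl⟩
  | succ N ih =>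
    obtain ⟨C, hC⟩ := ih (α - 1)
    exact ⟨max 1 (‖(α : ℂ)‖ * C),
      fun x hx => (hderiv α x hx).differentiableAt.differentiableWithinAt,
      key α _ (le_max_left _ _),
      ((hC.const_mul (α : ℂ)).mono (by linarith) (le_max_right _ _)).congr
        fun x hx => (hderiv α x hx).deriv⟩

theorem of_iteratedDeriv (hf : ContDiff ℝ (⊤ : ℕ∞) f)
    (hb : ∀ k ≤ N, ∀ x : ℝ, 1 ≤ x → ‖iteratedDeriv k f x‖ ≤ M * x ^ (m + δ * k)) :
    SymbolBound δ N m M f := by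
  induction N generalizing m f with
  | zero => exact ⟨hf.continuous.continuousOn, fun x hx => by simpa using hb 0 le_rfl x hx⟩
  | succ N ih =>
    have hf' := contDiff_infty_iff_deriv.1 hf
    refine ⟨hf'.1.differentiableOn, fun x hx => by simpa using hb 0 (Nat.zero_le _) x hx,
      ih hf'.2 fun k hk x hx => ?_⟩
    rw [← iteratedDeriv_succ']
    convert hb (k + 1) (by omega) x hx using 3
    push_cast
    ring

theorem of_eq_zero (hf : ContDiff ℝ (⊤ : ℕ∞) f) {r : ℝ} (hr : ∀ x, r < x → f x = 0)
    (δ : ℝ) (N : ℕ) (m : ℝ) : ∃ C, SymbolBound δ N m C f := by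
  have key : ∀ (f : ℝ → ℂ) (m : ℝ), Continuous f → (∀ x, r < x → f x = 0) →
      ∃ C, ∀ x : ℝ, 1 ≤ x → ‖f x‖ ≤ C * x ^ m := fun f m hf hr => by
    have hc : ContinuousOn (fun x : ℝ => f x * ((x ^ (-m) : ℝ) : ℂ)) (Icc 1 r) := by
      refine hf.continuousOn.mul (Complex.continuous_ofReal.comp_continuousOn ?_)
      exact continuousOn_id.rpow_const fun x hx =>
        Or.inl (zero_lt_one.trans_le hx.1).ne'
    obtain ⟨C, hC⟩ := isCompact_Icc.exists_bound_of_continuousOn hc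
    refine ⟨max C 0, fun x hx => ?_⟩
    have hx0 : 0 < x := by linarith
    rcases le_or_gt x r with hxr | hxr
    · have h := (hC x ⟨hx, hxr⟩).trans (le_max_left C 0)
      rwa [norm_mul, Complex.norm_real, Real.norm_of_nonneg (Real.rpow_nonneg hx0.le _),
        Real.rpow_neg hx0.le, ← div_eq_mul_inv, div_le_iff₀ (Real.rpow_pos_of_pos hx0 _)] at h
    · rw [hr x hxr, norm_zero]
      positivity
  induction N generalizing m f with
  | zero =>
    obtain ⟨C, hC⟩ := key f m hf.continuous hr
    exact ⟨C, hf.continuous.continuousOn, hC⟩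
  | succ N ih =>
    have hf' := contDiff_infty_iff_deriv.1 hf
    obtain ⟨C, hC⟩ := key f m hf.continuous hr
    obtain ⟨C', hC'⟩ := ih hf'.2 (fun x hx => by
      have h : f =ᶠ[𝓝 x] fun _ => 0 := by
        filter_upwards [Ioi_mem_nhds hx] with y hy using hr y hy
      simpa using h.deriv_eq) (m + δ)
    exact ⟨max C C', hf'.1.differentiableOn, fun x hx => (hC x hx).trans
      (mul_le_mul_of_nonneg_right (le_max_left _ _) (Real.rpow_nonneg (by linarith) _)),
      hC'.mono le_rfl (le_max_right _ _)⟩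

/-- Dilates of a function whose derivatives satisfy homogeneous bounds. -/
theorem comp_const_mul (hδ : -1 ≤ δ) (hf : ContDiff ℝ (⊤ : ℕ∞) f)
    (hb : ∀ k ≤ N, ∀ t : ℝ, 0 < t → ‖iteratedDeriv k f t‖ ≤ M * t ^ (m - k)) {ε : ℝ}
    (hε : 0 < ε) : SymbolBound δ N m (M * ε ^ m) (fun x => f (ε * x)) := by
  have hd : ∀ x : ℝ, HasDerivAt (fun x => f (ε * x)) ((ε : ℂ) * deriv f (ε * x)) x := fun x => by
    have h := ((contDiff_infty_iff_deriv.1 hf).1 (ε * x)).hasDerivAt.scomp x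
      ((hasDerivAt_id x).const_mul ε)
    simpa [Function.comp_def] using h
  have key : ∀ x : ℝ, 1 ≤ x → ‖f (ε * x)‖ ≤ M * ε ^ m * x ^ m := fun x hx => by
    have hx0 : 0 < x := by linarith
    rw [mul_assoc, ← Real.mul_rpow hε.le hx0.le]
    simpa using hb 0 (Nat.zero_le _) (ε * x) (by positivity)
  induction N generalizing m f with
  | zero => exact ⟨fun x _ => (hd x).continuousAt.continuousWithinAt, key⟩
  | succ N ih =>
    have hf' := contDiff_infty_iff_deriv.1 hf
    have h := ih (m := m - 1) hf'.2 (fun k hk t ht => by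
        rw [← iteratedDeriv_succ']
        convert hb (k + 1) (by omega) t ht using 3
        push_cast
        ring)
      (fun x => by
        have h := ((contDiff_infty_iff_deriv.1 hf'.2).1 (ε * x)).hasDerivAt.scomp x
          ((hasDerivAt_id x).const_mul ε)
        simpa [Function.comp_def] using h)
      (fun x hx => by
        have hx0 : 0 < x := by linarith
        rw [mul_assoc, ← Real.mul_rpow hε.le hx0.le]
        simpa [iteratedDeriv_one] using hb 1 (by omega) (ε * x) (by positivity))
    refine ⟨fun x _ => (hd x).differentiableAt.differentiableWithinAt, key,
      ((h.const_mul (ε : ℂ)).mono (by linarith) (le_of_eq ?_)).congr fun x _ => (hd x).deriv⟩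
    rw [Complex.norm_real, Real.norm_of_nonneg hε.le, Real.rpow_sub_one hε.ne']
    field_simp

end SymbolBound

/-- The operator `± L*`. -/
noncomputable def signedLstar (s lam p : ℝ) (g : ℝ → ℂ) : ℝ → ℂ :=
  fun y => (s : ℂ) * Lstar lam p g y

theorem div_phase_deriv_eq {p x : ℝ} (hx : 0 < x) (g : ℝ → ℂ) :
    g x / ((p * x ^ (p - 1) : ℝ) : ℂ) = (p : ℂ)⁻¹ * (g x * ((x ^ (-(p - 1)) : ℝ) : ℂ)) := by
  rw [Real.rpow_neg hx.le]
  push_cast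
  rw [div_eq_mul_inv, mul_inv]
  ring

namespace SymbolBound

variable {δ m M p s : ℝ} {N l : ℕ} {f g : ℝ → ℂ}

theorem exists_div_phase_deriv (hδ : -1 ≤ δ) (hp : 0 < p) (N : ℕ) :
    ∃ K, 0 ≤ K ∧ ∀ (m M : ℝ) (f : ℝ → ℂ), SymbolBound δ N m M f →
      SymbolBound δ N (m - (p - 1)) (K * M) (fun x => f x / ((p * x ^ (p - 1) : ℝ) : ℂ)) := by
  obtain ⟨C, hC⟩ := SymbolBound.rpow hδ N (-(p - 1))
  have hC0 := hC.nonneg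
  refine ⟨p⁻¹ * 2 ^ N * C, by positivity, fun m M f hf => ?_⟩
  refine (((hf.mul hC).const_mul (p : ℂ)⁻¹).mono (by linarith) (le_of_eq ?_)).congr
    fun x hx => div_phase_deriv_eq hx f
  rw [norm_inv, Complex.norm_real, Real.norm_of_nonneg hp.le]
  ring

theorem exists_signedLstar (hδ : -1 ≤ δ) (hp : 0 < p) (hs : |s| = 1) (N : ℕ) :
    ∃ K, 0 ≤ K ∧ ∀ lam, 0 < lam → ∀ (m M : ℝ) (f : ℝ → ℂ), SymbolBound δ (N + 1) m M f →
      SymbolBound δ N (m - (p - 1 - δ)) (K * M * lam⁻¹) (signedLstar s lam p f) := by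
  obtain ⟨K, hK0, hK⟩ := exists_div_phase_deriv hδ hp (N + 1)
  refine ⟨K, hK0, fun lam hlam m M f hf => ?_⟩
  refine (((hK m M f hf).2.2.const_mul (-(1 / (Complex.I * lam)))).const_mul (s : ℂ)).mono
    (by linarith) (le_of_eq ?_)
  rw [norm_neg, norm_div, norm_mul, Complex.norm_I, Complex.norm_real, Complex.norm_real,
    Real.norm_eq_abs, hs, Real.norm_of_nonneg hlam.le, norm_one]
  field_simp

theorem exists_iterate_signedLstar (hδ : -1 ≤ δ) (hp : 0 < p) (hs : |s| = 1) (l N : ℕ) :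
    ∃ K, 0 ≤ K ∧ ∀ lam, 0 < lam → ∀ (m M : ℝ) (f : ℝ → ℂ), SymbolBound δ (N + l) m M f →
      SymbolBound δ N (m - l * (p - 1 - δ)) (K * M * lam⁻¹ ^ l) ((signedLstar s lam p)^[l] f) := by
  induction l generalizing N with
  | zero => exact ⟨1, zero_le_one, fun lam _ m M f hf => by simpa using hf⟩
  | succ l ih =>
    obtain ⟨K, hK0, hK⟩ := ih (N + 1)
    obtain ⟨K', hK0', hK'⟩ := exists_signedLstar (p := p) hδ hp hs N
    refine ⟨K' * K, by positivity, fun lam hlam m M f hf => ?_⟩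
    rw [Function.iterate_succ_apply']
    refine (hK' lam hlam _ _ _ (hK lam hlam m M f (hf.of_le (by omega)))).mono
      (le_of_eq ?_) (le_of_eq ?_)
    · push_cast; ring
    · rw [pow_succ]; ring

theorem iterate_signedLstar_add (hδ : -1 ≤ δ) (hp : 0 < p) (hs : |s| = 1) {lam : ℝ}
    (hlam : 0 < lam) {m' M' : ℝ} (hf : SymbolBound δ l m M f) (hg : SymbolBound δ l m' M' g) :
    EqOn ((signedLstar s lam p)^[l] (fun x => f x + g x))
      (fun x => (signedLstar s lam p)^[l] f x + (signedLstar s lam p)^[l] g x) (Ioi 0) := by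
  induction l with
  | zero => exact fun x _ => rfl
  | succ l ih =>
    obtain ⟨K, -, hK⟩ := exists_iterate_signedLstar (p := p) hδ hp hs l 1
    obtain ⟨K', -, hK'⟩ := exists_div_phase_deriv (p := p) hδ hp 1
    have hdf := hK' _ _ _ (hK lam hlam _ _ _ (hf.of_le (by omega)))
    have hdg := hK' _ _ _ (hK lam hlam _ _ _ (hg.of_le (by omega)))
    intro x hx
    have h : (fun y => (signedLstar s lam p)^[l] (fun x => f x + g x) y /
        ((p * y ^ (p - 1) : ℝ) : ℂ)) =ᶠ[𝓝 x] fun y =>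
        (signedLstar s lam p)^[l] f y / ((p * y ^ (p - 1) : ℝ) : ℂ) +
        (signedLstar s lam p)^[l] g y / ((p * y ^ (p - 1) : ℝ) : ℂ) := by
      filter_upwards [Ioi_mem_nhds hx] with y hy
      rw [ih hf.of_succ hg.of_succ hy, add_div]
    simp only [Function.iterate_succ_apply', signedLstar, Lstar] at h ⊢
    rw [h.deriv_eq, deriv_fun_add (hdf.differentiableAt hx) (hdg.differentiableAt hx)]
    ring

theorem integrableOn_mul (h : SymbolBound δ N m M f) (hm : m < -1)
    (hf : ∀ x ∈ Ioo (0 : ℝ) 1, f x = 0) {e : ℝ → ℂ} (he : ContinuousOn e (Ioi 0))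
    (he1 : ∀ x, ‖e x‖ = 1) : IntegrableOn (fun x => e x * f x) (Ioi 0) := by
  have hsub : Ici (1 : ℝ) ⊆ Ioi 0 := Ici_subset_Ioi.2 zero_lt_one
  refine IntegrableOn.of_forall_sdiff_eq_zero (s := Ici 1) ?_ measurableSet_Ioi fun x hx => ?_
  · refine Integrable.mono' (g := fun x : ℝ => M * x ^ m) ?_ ?_ ?_
    · exact ((integrableOn_Ici_iff_integrableOn_Ioi).2
        (integrableOn_Ioi_rpow_of_lt hm one_pos)).const_mul M
    · exact ((he.mul h.continuousOn).mono hsub).aestronglyMeasurable measurableSet_Ici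
    · refine (ae_restrict_iff' measurableSet_Ici).2 (.of_forall fun x hx => ?_)
      rw [norm_mul, he1, one_mul]
      exact h.norm_le hx
  · rw [hf x ⟨hx.1, not_le.1 hx.2⟩, mul_zero]

theorem norm_integral_mul_le (h : SymbolBound δ N m M f) (hm : m < -1)
    (hf : ∀ x ∈ Ioo (0 : ℝ) 1, f x = 0) {e : ℝ → ℂ} (he1 : ∀ x, ‖e x‖ = 1) :
    ‖∫ x in Ioi (0 : ℝ), e x * f x‖ ≤ M * (-1 / (m + 1)) := by
  rw [setIntegral_eq_of_subset_of_forall_sdiff_eq_zero (s := Ici 1) measurableSet_Ioi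
    (Ici_subset_Ioi.2 zero_lt_one)
    fun x hx => by rw [hf x ⟨hx.1, not_le.1 hx.2⟩, mul_zero], integral_Ici_eq_integral_Ioi]
  have hint := (integrableOn_Ioi_rpow_of_lt hm one_pos).const_mul M
  refine (norm_integral_le_of_norm_le hint
    ((ae_restrict_iff' measurableSet_Ioi).2 (.of_forall fun x hx => ?_))).trans (le_of_eq ?_)
  · rw [norm_mul, he1, one_mul]
    exact h.norm_le (le_of_lt hx)
  · rw [integral_const_mul, integral_Ioi_rpow_of_lt hm one_pos, Real.one_rpow]

end SymbolBound

theorem iterate_signedLstar_eq_zero {s lam p : ℝ} {f : ℝ → ℂ} (l : ℕ)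
    (hf : ∀ x ∈ Ioo (0 : ℝ) 1, f x = 0) :
    ∀ x ∈ Ioo (0 : ℝ) 1, (signedLstar s lam p)^[l] f x = 0 := by
  induction l with
  | zero => exact hf
  | succ l ih =>
    intro x hx
    have h : (fun y => (signedLstar s lam p)^[l] f y / ((p * y ^ (p - 1) : ℝ) : ℂ)) =ᶠ[𝓝 x]
        fun _ => 0 := by
      filter_upwards [Ioo_mem_nhds hx.1 hx.2] with y hy
      rw [ih y hy, zero_div]
    simp only [Function.iterate_succ_apply', signedLstar, Lstar]
    rw [h.deriv_eq]
    simp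

/-- The oscillating factor `e^{± i λ x ^ p}`. -/
noncomputable def oscFactor (s lam p : ℝ) (x : ℝ) : ℂ :=
  Complex.exp (s * Complex.I * lam * ((x ^ p : ℝ) : ℂ))

theorem norm_oscFactor (s lam p x : ℝ) : ‖oscFactor s lam p x‖ = 1 := by
  have h : (s * Complex.I * lam * ((x ^ p : ℝ) : ℂ)) = ((s * lam * x ^ p : ℝ) : ℂ) * Complex.I := by
    push_cast; ring
  rw [oscFactor, h, Complex.norm_exp_ofReal_mul_I]

theorem hasDerivAt_oscFactor (s lam p : ℝ) {x : ℝ} (hx : 0 < x) :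
    HasDerivAt (oscFactor s lam p)
      (oscFactor s lam p x * (s * Complex.I * lam * ((p * x ^ (p - 1) : ℝ) : ℂ))) x :=
  ((Real.hasDerivAt_rpow_const (Or.inl hx.ne')).ofReal_comp.const_mul _).cexp

theorem continuousOn_oscFactor (s lam p : ℝ) : ContinuousOn (oscFactor s lam p) (Ioi 0) :=
  fun _ hx => (hasDerivAt_oscFactor s lam p hx).continuousAt.continuousWithinAt

/-- One integration by parts against the oscillating factor. -/
theorem SymbolBound.integral_oscFactor_mul {δ m M p s lam : ℝ} {f : ℝ → ℂ} (hδ : -1 ≤ δ)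
    (hp : 0 < p) (hδp : δ < p - 1) (hs : |s| = 1) (hlam : 0 < lam) (h : SymbolBound δ 1 m M f)
    (hm : m < -1) (hf : ∀ x ∈ Ioo (0 : ℝ) 1, f x = 0) :
    ∫ x in Ioi (0 : ℝ), oscFactor s lam p x * f x =
      ∫ x in Ioi (0 : ℝ), oscFactor s lam p x * signedLstar s lam p f x := by
  obtain ⟨K, -, hK⟩ := SymbolBound.exists_div_phase_deriv (p := p) hδ hp 1
  obtain ⟨K', -, hK'⟩ := SymbolBound.exists_signedLstar (p := p) hδ hp hs 0
  have hdiv := hK m M f h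
  have hs2 : (s : ℂ) * s = 1 := by
    rw [← Complex.ofReal_mul, ← abs_mul_abs_self, hs]; simp
  have hlam' : (lam : ℂ) ≠ 0 := by exact_mod_cast hlam.ne'
  have hI : Complex.I ≠ 0 := Complex.I_ne_zero
  have hs0 : (s : ℂ) ≠ 0 := fun h0 => by simp [h0] at hs2
  set c : ℂ := 1 / (s * Complex.I * lam) with hc
  set w : ℝ → ℂ := fun x => f x / ((p * x ^ (p - 1) : ℝ) : ℂ) with hw
  set e := oscFactor s lam p with he
  have hw0 : ∀ x ∈ Ioo (0 : ℝ) 1, w x = 0 := fun x hx => by simp only [hw, hf x hx, zero_div]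
  have hop : ∀ x, signedLstar s lam p f x = -(c * deriv w x) := fun x => by
    have : c = s * (1 / (Complex.I * lam)) := by
      rw [hc]; field_simp; linear_combination -hs2
    rw [this]; simp only [signedLstar, Lstar]; ring
  have hef : ∀ x ∈ Ioi (0 : ℝ),
      e x * (s * Complex.I * lam * ((p * x ^ (p - 1) : ℝ) : ℂ)) * (c * w x) = e x * f x := by
    intro x hx
    have hpx : ((p * x ^ (p - 1) : ℝ) : ℂ) ≠ 0 := by
      exact_mod_cast (mul_pos hp (Real.rpow_pos_of_pos hx _)).ne'
    simp only [hc, hw]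
    generalize ((p * x ^ (p - 1) : ℝ) : ℂ) = b at hpx
    field_simp
  have hint : IntegrableOn (fun x => e x * f x) (Ioi 0) :=
    h.integrableOn_mul hm hf (continuousOn_oscFactor s lam p) (norm_oscFactor s lam p)
  have hint' : IntegrableOn (fun x => e x * signedLstar s lam p f x) (Ioi 0) :=
    (hK' lam hlam m M f h).integrableOn_mul (by linarith)
      (iterate_signedLstar_eq_zero 1 hf) (continuousOn_oscFactor s lam p) (norm_oscFactor s lam p)
  have key := integral_Ioi_mul_deriv_eq_deriv_mul (a := 0) (a' := 0) (b' := 0) (u := e)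
    (v := fun x => c * w x) (v' := fun x => c * deriv w x)
    (fun x hx => hasDerivAt_oscFactor s lam p hx)
    (fun x hx => (hdiv.differentiableAt hx).hasDerivAt.const_mul c)
    (by
      refine hint'.neg.congr_fun (fun x _ => ?_) measurableSet_Ioi
      simp [hop])
    (hint.congr_fun (fun x hx => (hef x hx).symm) measurableSet_Ioi)
    (by
      refine tendsto_const_nhds.congr' ?_
      filter_upwards [Ioo_mem_nhdsGT zero_lt_one] with x hx
      simp [hw0 x hx])
    (by
      have hlim : Tendsto (fun x : ℝ => ‖c‖ * (K * M * x ^ (-(-(m - (p - 1)))))) atTop (𝓝 0) := by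
        have hpos : 0 < -(m - (p - 1)) := by linarith
        simpa only [mul_zero] using ((tendsto_rpow_neg_atTop hpos).const_mul (K * M)).const_mul ‖c‖
      refine squeeze_zero_norm' ?_ hlim
      filter_upwards [eventually_ge_atTop 1] with x hx
      rw [Pi.mul_apply, norm_mul, norm_oscFactor, one_mul, norm_mul, neg_neg]
      exact mul_le_mul_of_nonneg_left (hdiv.norm_le hx) (norm_nonneg _))
  rw [setIntegral_congr_fun measurableSet_Ioi hef, sub_zero, zero_sub] at key
  rw [← neg_neg (∫ x in Ioi (0 : ℝ), e x * f x), ← key, ← integral_neg]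
  exact setIntegral_congr_fun measurableSet_Ioi fun x _ => by simp [hop]

theorem SymbolBound.integral_oscFactor_mul_iterate {δ m M p s lam : ℝ} {f : ℝ → ℂ} {l : ℕ}
    (hδ : -1 ≤ δ) (hp : 0 < p) (hδp : δ < p - 1) (hs : |s| = 1) (hlam : 0 < lam)
    (h : SymbolBound δ l m M f) (hm : m < -1) (hf : ∀ x ∈ Ioo (0 : ℝ) 1, f x = 0) :
    ∫ x in Ioi (0 : ℝ), oscFactor s lam p x * f x =
      ∫ x in Ioi (0 : ℝ), oscFactor s lam p x * (signedLstar s lam p)^[l] f x := by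
  induction l with
  | zero => rfl
  | succ l ih =>
    obtain ⟨K, -, hK⟩ := SymbolBound.exists_iterate_signedLstar (p := p) hδ hp hs l 1
    have h1 := hK lam hlam m M f (h.of_le (by omega))
    have hl : 0 ≤ (l : ℝ) * (p - 1 - δ) := mul_nonneg (Nat.cast_nonneg l) (by linarith)
    rw [ih h.of_succ, h1.integral_oscFactor_mul hδ hp hδp hs hlam (by linarith)
      (iterate_signedLstar_eq_zero l hf), Function.iterate_succ_apply']

theorem one_add_sq_rpow_le {x : ℝ} (hx : 1 ≤ x) (r : ℝ) :
    (1 + x ^ 2) ^ (r / 2) ≤ 2 ^ (|r| / 2) * x ^ r := by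
  have hx0 : 0 < x := by linarith
  have hsq : (x ^ 2) ^ (r / 2) = x ^ r := by
    rw [← Real.rpow_natCast x 2, ← Real.rpow_mul hx0.le]
    congr 1
    push_cast
    ring
  rw [← hsq]
  rcases le_or_gt 0 r with hr | hr
  · rw [abs_of_nonneg hr, ← Real.mul_rpow (by norm_num) (by positivity)]
    exact Real.rpow_le_rpow (by positivity) (by nlinarith) (by linarith)
  · calc (1 + x ^ 2) ^ (r / 2) ≤ (x ^ 2) ^ (r / 2) :=
          Real.rpow_le_rpow_of_nonpos (by positivity) (by linarith) (by linarith)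
      _ ≤ 2 ^ (|r| / 2) * (x ^ 2) ^ (r / 2) :=
          le_mul_of_one_le_left (by positivity)
            (Real.one_le_rpow one_le_two (by positivity))

theorem AmpClass.norm_iteratedDeriv_le {τ δ : ℝ} {a : ℝ → ℂ} (ha : AmpClass τ δ a) {k l : ℕ}
    (hk : k ≤ l) (x : ℝ) :
    ‖iteratedDeriv k a x‖ ≤ ampSeminorm τ δ a l * (1 + x ^ 2) ^ ((τ + δ * k) / 2) := by
  have hpos : ∀ x : ℝ, 0 < 1 + x ^ 2 := fun x => by positivity
  have hcancel : ∀ x : ℝ,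
      (1 + x ^ 2) ^ (-(τ + δ * k) / 2) * (1 + x ^ 2) ^ ((τ + δ * k) / 2) = 1 := fun x => by
    rw [← Real.rpow_add (hpos x), neg_div, neg_add_cancel, Real.rpow_zero]
  have hbdd : BddAbove (range fun x : ℝ =>
      (1 + x ^ 2) ^ (-(τ + δ * k) / 2) * ‖iteratedDeriv k a x‖) := by
    obtain ⟨C, -, hC⟩ := ha.2 k
    refine ⟨C, ?_⟩
    rintro _ ⟨x, rfl⟩
    refine (mul_le_mul_of_nonneg_left (hC x) (Real.rpow_nonneg (hpos x).le _)).trans (le_of_eq ?_)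
    rw [mul_left_comm, hcancel, mul_one]
  have h1 := le_ciSup hbdd x
  have h2 : (⨆ x : ℝ, (1 + x ^ 2) ^ (-(τ + δ * k) / 2) * ‖iteratedDeriv k a x‖) ≤
      ampSeminorm τ δ a l :=
    le_ciSup (f := fun k : Fin (l + 1) => ⨆ x : ℝ,
      (1 + x ^ 2) ^ (-(τ + δ * ((k : ℕ) : ℝ)) / 2) * ‖iteratedDeriv k a x‖)
      (Finite.bddAbove_range _) ⟨k, Nat.lt_succ_of_le hk⟩
  calc ‖iteratedDeriv k a x‖
      = ((1 + x ^ 2) ^ (-(τ + δ * k) / 2) * ‖iteratedDeriv k a x‖) *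
          (1 + x ^ 2) ^ ((τ + δ * k) / 2) := by
        rw [mul_right_comm, hcancel, one_mul]
    _ ≤ _ := mul_le_mul_of_nonneg_right (h1.trans h2) (Real.rpow_nonneg (hpos x).le _)

theorem ampSeminorm_nonneg (τ δ : ℝ) (a : ℝ → ℂ) (l : ℕ) : 0 ≤ ampSeminorm τ δ a l :=
  Real.iSup_nonneg fun _ => Real.iSup_nonneg fun _ => by positivity

theorem AmpClass.symbolBound {τ δ : ℝ} {a : ℝ → ℂ} (ha : AmpClass τ δ a) (l : ℕ) :
    SymbolBound δ l τ (2 ^ ((|τ| + |δ| * l) / 2) * ampSeminorm τ δ a l) a := by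
  refine SymbolBound.of_iteratedDeriv ha.1 fun k hk x hx => ?_
  have hA := ampSeminorm_nonneg τ δ a l
  have hx0 : 0 < x := by linarith
  have habs : |τ + δ * k| ≤ |τ| + |δ| * l := by
    refine (abs_add_le _ _).trans (add_le_add le_rfl ?_)
    rw [abs_mul, Nat.abs_cast]
    exact mul_le_mul_of_nonneg_left (by exact_mod_cast hk) (abs_nonneg _)
  calc ‖iteratedDeriv k a x‖
      ≤ ampSeminorm τ δ a l * (1 + x ^ 2) ^ ((τ + δ * k) / 2) := ha.norm_iteratedDeriv_le hk x
    _ ≤ ampSeminorm τ δ a l * (2 ^ (|τ + δ * k| / 2) * x ^ (τ + δ * k)) :=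
        mul_le_mul_of_nonneg_left (one_add_sq_rpow_le hx _) hA
    _ ≤ ampSeminorm τ δ a l * (2 ^ ((|τ| + |δ| * l) / 2) * x ^ (τ + δ * k)) := by
        gcongr
        exact one_le_two
    _ = _ := by ring

namespace SchwartzMap

variable (χ : SchwartzMap ℝ ℂ)

theorem exists_forall_le_norm_iteratedDeriv (n N : ℕ) :
    ∃ C, 0 ≤ C ∧ ∀ k ≤ N, ∀ t : ℝ, 0 < t → t ^ (n + k) * ‖iteratedDeriv k χ t‖ ≤ C := by
  choose C hC0 hC using fun k => χ.decay (n + k) k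
  refine ⟨∑ k ∈ Finset.range (N + 1), C k, Finset.sum_nonneg fun k _ => (hC0 k).le,
    fun k hk t ht => ?_⟩
  have h := hC k t
  rw [Real.norm_of_nonneg ht.le, norm_iteratedFDeriv_eq_norm_iteratedDeriv] at h
  exact h.trans (Finset.single_le_sum (f := C) (fun k _ => (hC0 k).le)
    (Finset.mem_range.2 (Nat.lt_succ_of_le hk)))

theorem exists_forall_norm_iteratedDeriv_le (k : ℕ) :
    ∃ C, 0 ≤ C ∧ ∀ t : ℝ, ‖iteratedDeriv k χ t‖ ≤ C := by
  obtain ⟨C, hC0, hC⟩ := χ.decay 0 k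
  exact ⟨C, hC0.le, fun t => by
    simpa [norm_iteratedFDeriv_eq_norm_iteratedDeriv] using hC t⟩

theorem exists_symbolBound_comp_const_mul {δ : ℝ} (hδ : -1 ≤ δ) (n N : ℕ) :
    ∃ C, ∀ ε : ℝ, 0 < ε →
      SymbolBound δ N (-n) (C * ε ^ (-n : ℝ)) (fun x => χ (ε * x)) := by
  obtain ⟨C, -, hC⟩ := χ.exists_forall_le_norm_iteratedDeriv n N
  refine ⟨C, fun ε hε => SymbolBound.comp_const_mul hδ (χ.smooth _) (fun k hk t ht => ?_) hε⟩
  have h : t ^ (-(n : ℝ) - k) = (t ^ (n + k))⁻¹ := by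
    rw [← Real.rpow_natCast, ← Real.rpow_neg ht.le]
    congr 1
    push_cast
    ring
  rw [h, ← div_eq_mul_inv, le_div_iff₀ (by positivity), mul_comm]
  exact hC k hk t ht

theorem exists_symbolBound_comp_const_mul_sub_one (hχ : χ 0 = 1) {δ κ : ℝ} (hδ : -1 ≤ δ)
    (hκ0 : 0 < κ) (hκ1 : κ ≤ 1) (N : ℕ) :
    ∃ C, ∀ ε : ℝ, 0 < ε → SymbolBound δ N κ (C * ε ^ κ) (fun x => χ (ε * x) - 1) := by
  obtain ⟨A, hA0, hA⟩ := χ.exists_forall_le_norm_iteratedDeriv 0 N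
  choose B hB0 hB using χ.exists_forall_norm_iteratedDeriv_le
  have hsum : ∀ k ≤ N, B k ≤ ∑ j ∈ Finset.range (N + 1), B j := fun k hk =>
    Finset.single_le_sum (f := B) (fun k _ => hB0 k) (Finset.mem_range.2 (Nat.lt_succ_of_le hk))
  set S := ∑ j ∈ Finset.range (N + 1), B j
  have hS0 : 0 ≤ S := Finset.sum_nonneg fun k _ => hB0 k
  have hB1 := hB0 1
  have hC0 : 0 ≤ A + B 1 + S + 1 := by positivity
  refine ⟨A + B 1 + S + 1, fun ε hε => SymbolBound.comp_const_mul (f := fun t => χ t - 1) hδ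
    ((χ.smooth _).sub contDiff_const) (fun k hk t ht => ?_) hε⟩
  rcases k with _ | k
  · rw [iteratedDeriv_zero, Nat.cast_zero, sub_zero]
    rcases le_total t 1 with h1 | h1
    · have hlip : ‖χ t - χ 0‖ ≤ B 1 * ‖t - 0‖ :=
        convex_univ.norm_image_sub_le_of_norm_deriv_le (fun x _ => χ.differentiableAt)
          (fun x _ => by simpa [iteratedDeriv_one] using hB 1 x) (mem_univ _) (mem_univ _)
      rw [hχ, sub_zero, Real.norm_of_nonneg ht.le] at hlip
      have htκ : t ≤ t ^ κ := by
        simpa using Real.rpow_le_rpow_of_exponent_ge ht h1 hκ1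
      exact hlip.trans (mul_le_mul (by linarith) htκ ht.le hC0)
    · have h := hB 0 t
      rw [iteratedDeriv_zero] at h
      have h' := norm_sub_le (χ t) 1
      rw [norm_one] at h'
      have := hsum 0 (Nat.zero_le _)
      exact le_trans (by linarith) (le_mul_of_one_le_right hC0 (Real.one_le_rpow h1 hκ0.le))
  · have hd : iteratedDeriv (k + 1) (fun t => χ t - 1) t = iteratedDeriv (k + 1) χ t := by
      rw [iteratedDeriv_succ', iteratedDeriv_succ']
      congr 1
      funext y
      exact deriv_sub_const _
    rw [hd]
    rcases le_total t 1 with h1 | h1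
    · refine ((hB (k + 1) t).trans (hsum _ hk)).trans
        (le_trans (by linarith) (le_mul_of_one_le_right hC0
          (Real.one_le_rpow_of_pos_of_le_one_of_nonpos ht h1 ?_)))
      push_cast
      have : (0 : ℝ) ≤ k := Nat.cast_nonneg k
      linarith
    · have h := hA (k + 1) hk t ht
      rw [zero_add, mul_comm, ← le_div_iff₀ (by positivity), div_eq_mul_inv,
        ← Real.rpow_natCast, ← Real.rpow_neg ht.le] at h
      exact h.trans (mul_le_mul (by linarith)
        (Real.rpow_le_rpow_of_exponent_le h1 (by linarith)) (by positivity) hC0)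

theorem exists_apply_zero_eq_one : ∃ χ : SchwartzMap ℝ ℂ, χ 0 = 1 := by
  let b : ContDiffBump (0 : ℝ) := ⟨1, 2, one_pos, one_lt_two⟩
  have hb : HasCompactSupport (fun x => ((b x : ℝ) : ℂ)) :=
    b.hasCompactSupport.comp_left Complex.ofReal_zero
  have hsm : ContDiff ℝ (⊤ : ℕ∞) (fun x => ((b x : ℝ) : ℂ)) :=
    Complex.ofRealCLM.contDiff.comp b.contDiff
  have h0 : b 0 = 1 := b.one_of_mem_closedBall (Metric.mem_closedBall_self zero_le_one)
  refine ⟨hb.toSchwartzMap hsm, ?_⟩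
  change ((b 0 : ℝ) : ℂ) = 1
  rw [h0, Complex.ofReal_one]

end SchwartzMap

/-- The regularized oscillatory integrals of a symbol converge to the absolutely convergent
integral obtained by repeated integration by parts. -/
theorem SymbolBound.tendsto_integral_oscFactor_mul {δ m M p s lam : ℝ} {g : ℝ → ℂ} {l : ℕ}
    (hδ : -1 ≤ δ) (hp : 0 < p) (hδp : δ < p - 1) (hs : |s| = 1) (hlam : 0 < lam)
    (hg : SymbolBound δ l m M g) (hm : m - l * (p - 1 - δ) < -1)
    (hg0 : ∀ x ∈ Ioo (0 : ℝ) 1, g x = 0) (χ : SchwartzMap ℝ ℂ) (hχ : χ 0 = 1) :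
    Tendsto (fun ε : ℝ => ∫ x in Ioi (0 : ℝ), oscFactor s lam p x * (g x * χ (ε * x)))
      (𝓝[>] 0) (𝓝 (∫ x in Ioi (0 : ℝ), oscFactor s lam p x * (signedLstar s lam p)^[l] g x)) := by
  obtain ⟨n, hn⟩ := exists_nat_gt (m + 1)
  obtain ⟨κ, hκ0, hκ1, hκ⟩ : ∃ κ : ℝ, 0 < κ ∧ κ ≤ 1 ∧ m + κ - l * (p - 1 - δ) < -1 := by
    refine ⟨min 1 ((-1 - (m - l * (p - 1 - δ))) / 2), lt_min one_pos (by linarith),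
      min_le_left _ _, ?_⟩
    have := min_le_right 1 ((-1 - (m - l * (p - 1 - δ))) / 2)
    linarith
  obtain ⟨C, hC⟩ := χ.exists_symbolBound_comp_const_mul hδ n l
  obtain ⟨C', hC'⟩ := χ.exists_symbolBound_comp_const_mul_sub_one hχ hδ hκ0 hκ1 l
  obtain ⟨K, -, hK⟩ := SymbolBound.exists_iterate_signedLstar (p := p) hδ hp hs l 0
  have hgl := hK lam hlam m M g (by rwa [zero_add])
  rw [tendsto_iff_norm_sub_tendsto_zero]
  have hlim : Tendsto (fun ε : ℝ => K * (2 ^ l * M * (C' * ε ^ κ)) * lam⁻¹ ^ l *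
      (-1 / (m + κ - l * (p - 1 - δ) + 1))) (𝓝[>] 0) (𝓝 0) := by
    have h0 : Tendsto (fun ε : ℝ => ε ^ κ) (𝓝[>] 0) (𝓝 0) := by
      have := (Real.continuousAt_rpow_const 0 κ (Or.inr hκ0.le)).tendsto
      rw [Real.zero_rpow hκ0.ne'] at this
      exact this.mono_left nhdsWithin_le_nhds
    simpa only [mul_zero, zero_mul] using ((((h0.const_mul C').const_mul (2 ^ l * M)).const_mul
      K).mul_const (lam⁻¹ ^ l)).mul_const (-1 / (m + κ - l * (p - 1 - δ) + 1))
  refine squeeze_zero' (.of_forall fun _ => norm_nonneg _) ?_ hlim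
  filter_upwards [self_mem_nhdsWithin] with ε hε
  have hr := hg.mul (hC' ε hε)
  have hr0 : ∀ x ∈ Ioo (0 : ℝ) 1, g x * (χ (ε * x) - 1) = 0 := fun x hx => by
    rw [hg0 x hx, zero_mul]
  have hrl := hK lam hlam _ _ _ (by rwa [zero_add])
  have hsplit : (fun x => g x * χ (ε * x)) = fun x => g x + g x * (χ (ε * x) - 1) := by
    funext x; ring
  have hsum := SymbolBound.iterate_signedLstar_add (p := p) hδ hp hs hlam hg hr
  rw [(hg.mul (hC ε hε)).integral_oscFactor_mul_iterate hδ hp hδp hs hlam (by linarith)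
    (fun x hx => by rw [hg0 x hx, zero_mul]), hsplit,
    setIntegral_congr_fun (g := fun x => oscFactor s lam p x * (signedLstar s lam p)^[l] g x +
      oscFactor s lam p x * (signedLstar s lam p)^[l] (fun x => g x * (χ (ε * x) - 1)) x)
      measurableSet_Ioi (fun x hx => by simp only [hsum hx, mul_add]),
    integral_add
      (hgl.integrableOn_mul hm (iterate_signedLstar_eq_zero l hg0)
        (continuousOn_oscFactor s lam p) (norm_oscFactor s lam p))
      (hrl.integrableOn_mul hκ (iterate_signedLstar_eq_zero l hr0)
        (continuousOn_oscFactor s lam p) (norm_oscFactor s lam p)), add_sub_cancel_left]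
  exact hrl.norm_integral_mul_le hκ (iterate_signedLstar_eq_zero l hr0) (norm_oscFactor s lam p)

theorem IsCutoff.exists_symbolBound_one_sub {φ : ℝ → ℂ} (hφ : IsCutoff φ) {δ : ℝ} (hδ : -1 ≤ δ)
    (N : ℕ) : ∃ C, SymbolBound δ N 0 C (fun x => 1 - φ x) := by
  obtain ⟨hsm, r₀, r₁, -, -, -, hr₁⟩ := hφ
  obtain ⟨C, hC⟩ := SymbolBound.of_eq_zero hsm
    (fun x hx => hr₁ x (hx.le.trans (le_abs_self x))) δ N 0
  obtain ⟨C', hC'⟩ := SymbolBound.rpow hδ N 0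
  refine ⟨_, (hC'.add (hC.const_mul (-1))).congr fun x _ => ?_⟩
  simp [sub_eq_add_neg]

theorem AmpClass.exists_symbolBound_mul_one_sub {τ δ : ℝ} {a φ : ℝ → ℂ} (ha : AmpClass τ δ a)
    (hφ : IsCutoff φ) (hδ : -1 ≤ δ) (q : ℝ) (l : ℕ) :
    ∃ C, 0 ≤ C ∧ SymbolBound δ l (q - 1 + τ) (C * ampSeminorm τ δ a l)
      (fun y => ((y ^ (q - 1) : ℝ) : ℂ) * a y * (1 - φ y)) := by
  obtain ⟨A, hA⟩ := SymbolBound.rpow hδ l (q - 1)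
  obtain ⟨B, hB⟩ := hφ.exists_symbolBound_one_sub hδ l
  have hA0 := hA.nonneg
  have hB0 := hB.nonneg
  refine ⟨2 ^ l * (2 ^ l * A * 2 ^ ((|τ| + |δ| * l) / 2)) * B, by positivity,
    ((hA.mul (ha.symbolBound l)).mul hB).mono (by linarith) (le_of_eq (by ring))⟩

/-- **Existence and estimate of the oscillatory integral `Ĩ^±_{p,q}[aψ](λ)`** (double signs
in the same order, encoded by `s = ±1`).  Writing `l_{p,q} = ⌊(q+τ)⁺/(p-1-δ)⌋ + 1`, the
oscillatory integral exists (the limit is independent of `χ`), equals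
`∫₀^∞ e^{±iλx^p} (±L*)^l (x^{q-1} a ψ) dx` for every `l ≥ l_{p,q}` (absolutely convergent),
and satisfies `|Ĩ^±_{p,q}[aψ](λ)| ≤ C_l |a|^{(τ)}_l λ^{-l}` for all `λ > 0`. -/
theorem oscillatory_tail_part (p q τ δ : ℝ) (hp : 0 < p) (hq : 0 < q)
    (hδ₁ : -1 ≤ δ) (hδ₂ : δ < p - 1) (a : ℝ → ℂ) (ha : AmpClass τ δ a)
    (φ : ℝ → ℂ) (hφ : IsCutoff φ) (s : ℝ) (hs : s = 1 ∨ s = -1) :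
    ∃ I : ℝ → ℂ,
      (∀ lam : ℝ, 0 < lam → ∀ χ : SchwartzMap ℝ ℂ, χ 0 = 1 →
        Tendsto
          (fun ε : ℝ => ∫ x in Set.Ioi (0 : ℝ),
            Complex.exp (s * Complex.I * lam * ((x ^ p : ℝ) : ℂ)) *
              (((x ^ (q - 1) : ℝ) : ℂ) * a x * (1 - φ x) * χ (ε * x)))
          (𝓝[>] (0 : ℝ)) (𝓝 (I lam))) ∧
      (∀ l : ℕ, (⌊max (q + τ) 0 / (p - 1 - δ)⌋ + 1 : ℤ) ≤ (l : ℤ) → ∀ lam : ℝ, 0 < lam →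
        IntegrableOn
          (fun x : ℝ => Complex.exp (s * Complex.I * lam * ((x ^ p : ℝ) : ℂ)) *
            (fun g => fun y => (s : ℂ) * Lstar lam p g y)^[l]
              (fun y => ((y ^ (q - 1) : ℝ) : ℂ) * a y * (1 - φ y)) x)
          (Set.Ioi 0) ∧
        I lam =
          ∫ x in Set.Ioi (0 : ℝ),
            Complex.exp (s * Complex.I * lam * ((x ^ p : ℝ) : ℂ)) *
              (fun g => fun y => (s : ℂ) * Lstar lam p g y)^[l]
                (fun y => ((y ^ (q - 1) : ℝ) : ℂ) * a y * (1 - φ y)) x) ∧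
      (∀ l : ℕ, (⌊max (q + τ) 0 / (p - 1 - δ)⌋ + 1 : ℤ) ≤ (l : ℤ) →
        ∃ C : ℝ, 0 < C ∧ ∀ lam : ℝ, 0 < lam →
          ‖I lam‖ ≤ C * ampSeminorm τ δ a l * lam ^ (-(l : ℝ))) := by
  have hs' : |s| = 1 := by rcases hs with rfl | rfl <;> simp
  set d := p - 1 - δ with hd
  have hd0 : 0 < d := by linarith
  set g : ℝ → ℂ := fun y => ((y ^ (q - 1) : ℝ) : ℂ) * a y * (1 - φ y) with hg
  have hg0 : ∀ x ∈ Ioo (0 : ℝ) 1, g x = 0 := fun x hx => by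
    obtain ⟨-, r₀, r₁, hr₀, -, hφ1, -⟩ := hφ
    have h1 : φ x = 1 := hφ1 x (by rw [abs_of_pos hx.1]; linarith [hx.2])
    simp only [hg, h1, sub_self, mul_zero]
  have hexp : ∀ l : ℕ, (⌊max (q + τ) 0 / d⌋ + 1 : ℤ) ≤ (l : ℤ) → q - 1 + τ - l * d < -1 := by
    intro l hl
    have h1 : max (q + τ) 0 / d < l :=
      (Int.lt_floor_add_one _).trans_le (by exact_mod_cast hl)
    rw [div_lt_iff₀ hd0] at h1
    linarith [le_max_left (q + τ) 0]
  obtain ⟨l₀, hl₀⟩ : ∃ l₀ : ℕ, (⌊max (q + τ) 0 / d⌋ + 1 : ℤ) ≤ (l₀ : ℤ) :=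
    ⟨_, Int.self_le_toNat _⟩
  have hlim : ∀ l : ℕ, (⌊max (q + τ) 0 / d⌋ + 1 : ℤ) ≤ (l : ℤ) → ∀ lam : ℝ, 0 < lam →
      ∀ χ : SchwartzMap ℝ ℂ, χ 0 = 1 → Tendsto
        (fun ε : ℝ => ∫ x in Ioi (0 : ℝ), oscFactor s lam p x * (g x * χ (ε * x))) (𝓝[>] 0)
        (𝓝 (∫ x in Ioi (0 : ℝ), oscFactor s lam p x * (signedLstar s lam p)^[l] g x)) := by
    intro l hl lam hlam χ hχ
    obtain ⟨C, -, hC⟩ := ha.exists_symbolBound_mul_one_sub hφ hδ₁ q l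
    exact hC.tendsto_integral_oscFactor_mul hδ₁ hp hδ₂ hs' hlam (hexp l hl) hg0 χ hχ
  have heq : ∀ l : ℕ, (⌊max (q + τ) 0 / d⌋ + 1 : ℤ) ≤ (l : ℤ) → ∀ lam : ℝ, 0 < lam →
      ∫ x in Ioi (0 : ℝ), oscFactor s lam p x * (signedLstar s lam p)^[l₀] g x =
        ∫ x in Ioi (0 : ℝ), oscFactor s lam p x * (signedLstar s lam p)^[l] g x := by
    intro l hl lam hlam
    obtain ⟨χ, hχ⟩ := SchwartzMap.exists_apply_zero_eq_one
    exact tendsto_nhds_unique (hlim l₀ hl₀ lam hlam χ hχ) (hlim l hl lam hlam χ hχ)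
  refine ⟨fun lam => ∫ x in Ioi (0 : ℝ), oscFactor s lam p x * (signedLstar s lam p)^[l₀] g x,
    fun lam hlam χ hχ => hlim l₀ hl₀ lam hlam χ hχ,
    fun l hl lam hlam => ⟨?_, heq l hl lam hlam⟩, fun l hl => ?_⟩
  · obtain ⟨C, -, hC⟩ := ha.exists_symbolBound_mul_one_sub hφ hδ₁ q l
    obtain ⟨K, -, hK⟩ := SymbolBound.exists_iterate_signedLstar (p := p) hδ₁ hp hs' l 0
    exact (hK lam hlam _ _ _ (by rwa [zero_add])).integrableOn_mul (hexp l hl)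
      (iterate_signedLstar_eq_zero l hg0) (continuousOn_oscFactor s lam p)
      (norm_oscFactor s lam p)
  · obtain ⟨C, hC0, hC⟩ := ha.exists_symbolBound_mul_one_sub hφ hδ₁ q l
    obtain ⟨K, hK0, hK⟩ := SymbolBound.exists_iterate_signedLstar (p := p) hδ₁ hp hs' l 0
    have hneg : 0 ≤ -1 / (q - 1 + τ - l * d + 1) :=
      div_nonneg_of_nonpos (by norm_num) (by linarith [hexp l hl])
    refine ⟨K * C * (-1 / (q - 1 + τ - l * d + 1)) + 1, by positivity, fun lam hlam => ?_⟩
    have hb := (hK lam hlam _ _ _ (by rwa [zero_add])).norm_integral_mul_le (hexp l hl)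
      (iterate_signedLstar_eq_zero l hg0) (norm_oscFactor s lam p)
    have hA := ampSeminorm_nonneg τ δ a l
    dsimp only
    rw [heq l hl lam hlam, Real.rpow_neg hlam.le, Real.rpow_natCast, ← inv_pow]
    refine hb.trans ?_
    have : 0 ≤ ampSeminorm τ δ a l * lam⁻¹ ^ l := by positivity
    linarith
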